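/- Assume (A3) and (A6), and let (f₋, f₊) be the unique solution of Luckock's equation. Define for x ∈ I: w⁽⁻⁾₋(x) := u₋₊(x)/λ₊(I₋), w⁽⁻⁾₊(x) := −(1 − u₊₋(x))/λ₊(I₋), w⁽⁺⁾₋(x) := −(1 − u₋₊(x))/λ₋(I₊), and w⁽⁺⁾₊(x) := u₊₋(x)/λ₋(I₊). Then f₊(I₊) > 0 if and only if inf_{x ∈ I} [w⁽⁻⁾₋(x) + w⁽⁺⁾₋(x)] > 0, and f₋(I₋) > 0 if and only if inf_{x ∈ I} [w⁽⁻⁾₊(x) + w⁽⁺⁾₊(x)] > 0; both equivalences also hold with '>' replaced by '<'. -/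

import Mathlib

open MeasureTheory Set
open scoped ENNReal

noncomputable section

/-- The right limit of `f` at `x`, with the convention `f(b+) := f b` at the
right endpoint `b`. -/
def rLim (b : ℝ) (f : ℝ → ℝ) (x : ℝ) : ℝ :=
  if x < b then Function.rightLim f x else f b

/-- `ν` is the Lebesgue-Stieltjes signed measure `df` of `f` on the interval `[a,b]`,
with the conventions `f(a−) := f a` and `f(b+) := f b`. -/
def IsLS (a b : ℝ) (f : ℝ → ℝ) (ν : MeasureTheory.SignedMeasure ℝ) : Prop :=
  (∀ s : Set ℝ, MeasurableSet s → s ∩ Set.Icc a b = ∅ → ν s = 0) ∧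
  (∀ x y : ℝ, a ≤ x → x ≤ y → y ≤ b → ν (Set.Ioc x y) = rLim b f y - rLim b f x) ∧
  ν {a} = rLim b f a - f a

/-- The integral `∫_s g dν` of `g` over `s` against the signed measure `ν`. -/
def sInt (ν : MeasureTheory.SignedMeasure ℝ) (g : ℝ → ℝ) (s : Set ℝ) : ℝ :=
  (∫ x in s, g x ∂ν.toJordanDecomposition.posPart) -
    ∫ x in s, g x ∂ν.toJordanDecomposition.negPart

/-- Assumption (A3): `lm` (demand) is continuous and nonincreasing, `lp` (supply) is
continuous and nondecreasing on `[a,b]`; both are nonnegative. -/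
def A3 (a b : ℝ) (lm lp : ℝ → ℝ) : Prop :=
  ContinuousOn lm (Set.Icc a b) ∧ ContinuousOn lp (Set.Icc a b) ∧
  AntitoneOn lm (Set.Icc a b) ∧ MonotoneOn lp (Set.Icc a b) ∧
  (∀ x ∈ Set.Icc a b, 0 ≤ lm x) ∧ (∀ x ∈ Set.Icc a b, 0 ≤ lp x)

/-- Assumption (A6): the rates of market orders are positive. -/
def A6 (a b : ℝ) (lm lp : ℝ → ℝ) : Prop := 0 < lp a ∧ 0 < lm b

/-- `(fm, fp)` is a solution of Luckock's equation on `[a,b]` for demand/supply `lm, lp`: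
both are continuous of bounded variation, `fm dlp + lm dfp = 0` and `fp dlm + lp dfm = 0`
as signed measures on `[a,b]`, and `fm b = 1 = fp a`. -/
def LuckockSol (a b : ℝ) (lm lp fm fp : ℝ → ℝ) : Prop :=
  ContinuousOn fm (Set.Icc a b) ∧ ContinuousOn fp (Set.Icc a b) ∧
  BoundedVariationOn fm (Set.Icc a b) ∧ BoundedVariationOn fp (Set.Icc a b) ∧
  fm b = 1 ∧ fp a = 1 ∧
  ∀ νlm νlp νfm νfp : MeasureTheory.SignedMeasure ℝ,
    IsLS a b lm νlm → IsLS a b lp νlp → IsLS a b fm νfm → IsLS a b fp νfp →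
    ∀ s : Set ℝ, MeasurableSet s →
      sInt νlp fm s + sInt νfp lm s = 0 ∧ sInt νlm fp s + sInt νfm lp s = 0

/-- The constant `Γ`, computed from the Lebesgue-Stieltjes measure `νip` of `1/λ₊`. -/
def Gam (a b : ℝ) (lm lp : ℝ → ℝ) (νip : MeasureTheory.SignedMeasure ℝ) : ℝ :=
  (lm b * lp b)⁻¹ - sInt νip (fun x => (lm x)⁻¹) (Set.Icc a b)

/-- The function `u₋₊`, where `νip` is the Lebesgue-Stieltjes measure of `1/λ₊`. -/
def ump (a b : ℝ) (lm lp : ℝ → ℝ) (νip : MeasureTheory.SignedMeasure ℝ) (x : ℝ) : ℝ :=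
  (Gam a b lm lp νip)⁻¹ *
    ((lm b * lp b)⁻¹ - sInt νip (fun t => (lm t)⁻¹) (Set.Ioc x b))

/-- The function `u₊₋`, where `νim` is the Lebesgue-Stieltjes measure of `1/λ₋`. -/
def upm (a b : ℝ) (lm lp : ℝ → ℝ) (νip νim : MeasureTheory.SignedMeasure ℝ) (x : ℝ) : ℝ :=
  (Gam a b lm lp νip)⁻¹ *
    ((lm a * lp a)⁻¹ + sInt νim (fun t => (lp t)⁻¹) (Set.Ioc a x))

open Filter Topology Asymptotics

/-- The filter of pairs `a ≤ x ≤ y ≤ b` with `y - x` tending to `0`, uniformly. -/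
def meshFilter (a b : ℝ) : Filter (ℝ × ℝ) :=
  uniformity ℝ ⊓ 𝓟 {p | a ≤ p.1 ∧ p.1 ≤ p.2 ∧ p.2 ≤ b}

/-- The mass that `μ` gives to `(x, y]`, as a function of the pair `(x, y)`. -/
def massIoc (μ : Measure ℝ) (p : ℝ × ℝ) : ℝ := μ.real (Ioc p.1 p.2)

/-- The increment `f y - f x`, as a function of the pair `(x, y)`. -/
def incr (f : ℝ → ℝ) (p : ℝ × ℝ) : ℝ := f p.2 - f p.1

section

variable {a b : ℝ}

theorem meshFilter_mono {x y : ℝ} (hx : a ≤ x) (hy : y ≤ b) :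
    meshFilter x y ≤ meshFilter a b :=
  inf_le_inf_left _ (principal_mono.2 fun _ hp => ⟨hx.trans hp.1, hp.2.1, hp.2.2.trans hy⟩)

theorem eventually_mem_meshFilter :
    ∀ᶠ p in meshFilter a b, a ≤ p.1 ∧ p.1 ≤ p.2 ∧ p.2 ≤ b :=
  mem_inf_of_right (mem_principal_self _)

theorem eventually_fst_mem : ∀ᶠ p in meshFilter a b, p.1 ∈ Icc a b := by
  filter_upwards [eventually_mem_meshFilter] with p hp using ⟨hp.1, hp.2.1.trans hp.2.2⟩

theorem eventually_snd_mem : ∀ᶠ p in meshFilter a b, p.2 ∈ Icc a b := by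
  filter_upwards [eventually_mem_meshFilter] with p hp using ⟨hp.1.trans hp.2.1, hp.2.2⟩

theorem le_of_increment_le_isLittleO_aux {μ : Measure ℝ} [IsFiniteMeasure μ] (hab : a ≤ b)
    {H : ℝ → ℝ} {D : ℝ × ℝ → ℝ} (hD : D =o[meshFilter a b] massIoc μ)
    (hH : ∀ᶠ p in meshFilter a b, incr H p ≤ D p) : H b ≤ H a := by
  have key : ∀ ε > 0, H b - H a ≤ ε * massIoc μ (a, b) := by
    intro ε hε
    have h1 := (hD.bound hε).and hH
    rw [meshFilter, eventually_inf_principal, Metric.uniformity_basis_dist.eventually_iff] at h1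
    obtain ⟨δ, hδ, h1⟩ := h1
    obtain ⟨n, hn⟩ := exists_nat_gt ((b - a) / δ)
    have hn0 : (0 : ℝ) < n := lt_of_le_of_lt (div_nonneg (sub_nonneg.2 hab) hδ.le) hn
    set h := (b - a) / n with hh
    have hh0 : 0 ≤ h := div_nonneg (sub_nonneg.2 hab) hn0.le
    have hhδ : h < δ := by
      rw [hh, div_lt_iff₀ hn0]; rw [div_lt_iff₀ hδ] at hn; linarith
    have hnh : n * h = b - a := by rw [hh]; field_simp
    have step : ∀ k : ℕ, k ≤ n → H (a + k * h) - H a ≤ ε * massIoc μ (a, a + k * h) := by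
      intro k
      induction k with
      | zero => intro _; simp [massIoc]
      | succ k ih =>
        intro hk
        have ihk := ih (by omega)
        have hkn : ((k + 1 : ℕ) : ℝ) * h ≤ b - a := by
          rw [← hnh]; gcongr
        have e : a + ((k + 1 : ℕ) : ℝ) * h = a + k * h + h := by push_cast; ring
        have hk0 : 0 ≤ (k : ℝ) * h := by positivity
        rw [e]
        have h2 := @h1 (a + k * h, a + k * h + h)
          (by simp [Real.dist_eq, abs_of_nonneg hh0, hhδ])
          ⟨by simp; positivity, by simpa using hh0, by simp only; linarith⟩
        have h3 : massIoc μ (a, a + k * h + h) =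
            massIoc μ (a, a + k * h) + massIoc μ (a + k * h, a + k * h + h) := by
          simp only [massIoc]
          rw [← measureReal_union (Ioc_disjoint_Ioc_of_le le_rfl) measurableSet_Ioc,
            Ioc_union_Ioc_eq_Ioc (by linarith) (by linarith)]
        have h4 := le_abs_self (D (a + k * h, a + k * h + h))
        have h5 : ‖massIoc μ (a + k * h, a + k * h + h)‖ =
          massIoc μ (a + k * h, a + k * h + h) := by simp [massIoc]
        rw [h5, Real.norm_eq_abs] at h2
        simp only [incr] at h2
        rw [h3]
        linarith [h2.1, h2.2]
    have := step n le_rfl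
    rwa [hnh, add_sub_cancel] at this
  have : Tendsto (fun ε : ℝ => ε * massIoc μ (a, b)) (𝓝[>] 0) (𝓝 0) := by
    have h : Tendsto (fun ε : ℝ => ε * massIoc μ (a, b)) (𝓝 0) (𝓝 (0 * massIoc μ (a, b))) :=
      (continuous_id.mul continuous_const).tendsto 0
    rw [zero_mul] at h
    exact h.mono_left nhdsWithin_le_nhds
  have := ge_of_tendsto this (eventually_nhdsWithin_of_forall key)
  linarith

/-- A function whose increments are bounded above by `o(μ (x, y])` is nonincreasing. -/
theorem le_of_increment_le_isLittleO {μ : Measure ℝ} [IsFiniteMeasure μ]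
    {H : ℝ → ℝ} {D : ℝ × ℝ → ℝ} (hD : D =o[meshFilter a b] massIoc μ)
    (hH : ∀ᶠ p in meshFilter a b, incr H p ≤ D p) {x y : ℝ} (hx : a ≤ x) (hxy : x ≤ y)
    (hy : y ≤ b) : H y ≤ H x :=
  le_of_increment_le_isLittleO_aux hxy (hD.mono (meshFilter_mono hx hy))
    (hH.filter_mono (meshFilter_mono hx hy))

/-- A function whose increments are `o(μ (x, y])` is constant. -/
theorem eq_of_increment_isLittleO {μ : Measure ℝ} [IsFiniteMeasure μ]
    {H : ℝ → ℝ} (hH : incr H =o[meshFilter a b] massIoc μ) {x y : ℝ} (hx : a ≤ x)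
    (hxy : x ≤ y) (hy : y ≤ b) : H y = H x := by
  refine le_antisymm (le_of_increment_le_isLittleO hH (.of_forall fun _ => le_rfl) hx hxy hy) ?_
  have := le_of_increment_le_isLittleO (H := fun x => -H x) hH.neg_left
    (.of_forall fun p => by simp [incr]) hx hxy hy
  linarith

theorem incr_isLittleO_one {g : ℝ → ℝ} (hg : ContinuousOn g (Icc a b)) :
    incr g =o[meshFilter a b] (fun _ => (1 : ℝ)) := by
  rw [isLittleO_one_iff, Metric.tendsto_nhds]
  intro ε hε
  have h := Metric.uniformContinuousOn_iff.1 (isCompact_Icc.uniformContinuousOn_of_continuous hg)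
    ε hε
  obtain ⟨δ, hδ, h⟩ := h
  have h2 : ∀ᶠ p in meshFilter a b, dist p.1 p.2 < δ :=
    mem_inf_of_left (Metric.dist_mem_uniformity hδ)
  filter_upwards [eventually_fst_mem, eventually_snd_mem, h2] with p h3 h4 h5
  have := h _ h3 _ h4 h5
  rwa [incr, dist_zero_right, ← dist_eq_norm, dist_comm]

theorem fst_isBigO_one {g : ℝ → ℝ} (hg : ContinuousOn g (Icc a b)) :
    (fun p : ℝ × ℝ => g p.1) =O[meshFilter a b] (fun _ => (1 : ℝ)) := by
  obtain ⟨C, hC⟩ := isCompact_Icc.exists_bound_of_continuousOn hg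
  refine IsBigO.of_bound C ?_
  filter_upwards [eventually_fst_mem] with p hp
  simpa using hC _ hp

/-- A signed measure `ν` gives mass `F y - F x` to every `(x, y] ⊆ (a, b]`. -/
def HasIncr (a b : ℝ) (F : ℝ → ℝ) (ν : SignedMeasure ℝ) : Prop :=
  ∀ x y, a ≤ x → x ≤ y → y ≤ b → ν (Ioc x y) = F y - F x

theorem rLim_eq {F : ℝ → ℝ} (hF : ContinuousOn F (Icc a b)) {x : ℝ} (hx : x ∈ Icc a b) :
    rLim b F x = F x := by
  unfold rLim
  split_ifs with h
  · refine rightLim_eq_of_tendsto ?_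
    rw [← nhdsWithin_Ioo_eq_nhdsGT h]
    exact (hF x hx).mono fun z hz => ⟨hx.1.trans hz.1.le, hz.2.le⟩
  · rw [le_antisymm hx.2 (not_lt.1 h)]

theorem IsLS.hasIncr {F : ℝ → ℝ} {ν : SignedMeasure ℝ} (h : IsLS a b F ν)
    (hF : ContinuousOn F (Icc a b)) : HasIncr a b F ν := by
  intro x y hx hxy hy
  rw [h.2.1 x y hx hxy hy, rLim_eq hF ⟨hx.trans hxy, hy⟩, rLim_eq hF ⟨hx, hxy.trans hy⟩]

theorem exists_isLS (hab : a ≤ b) {F : ℝ → ℝ} (hF : ContinuousOn F (Icc a b))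
    (hbv : BoundedVariationOn F (Icc a b)) : ∃ ν, IsLS a b F ν := by
  set G : ℝ → ℝ := F ∘ fun x => (projIcc a b hab x : ℝ) with hG
  have hGbv : BoundedVariationOn G univ := by
    refine ne_top_of_le_ne_top hbv
      (eVariationOn.comp_le_of_monotoneOn F _ (fun x _ y _ h => ?_) fun x _ => (projIcc a b hab x).2)
    exact monotone_projIcc hab h
  have hGc : Continuous G :=
    hF.comp_continuous (continuous_subtype_val.comp continuous_projIcc) fun x =>
      (projIcc a b hab x).2
  have hGF : ∀ x ∈ Icc a b, G x = F x := fun x hx => by simp [hG, projIcc_of_mem hab hx]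
  have hr : ∀ x, Function.rightLim G x = G x := fun x => hGc.continuousWithinAt.rightLim_eq
  have hl : ∀ x, Function.leftLim G x = G x := fun x => hGc.continuousWithinAt.leftLim_eq
  refine ⟨hGbv.vectorMeasure.restrict (Icc a b), ?_, ?_, ?_⟩
  · intro s hs h
    rw [VectorMeasure.restrict_apply _ measurableSet_Icc hs, h, VectorMeasure.empty]
  · intro x y hx hxy hy
    have hx' : x ∈ Icc a b := ⟨hx, hxy.trans hy⟩
    have hy' : y ∈ Icc a b := ⟨hx.trans hxy, hy⟩
    rw [VectorMeasure.restrict_apply _ measurableSet_Icc measurableSet_Ioc,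
      inter_eq_left.2 (Ioc_subset_Icc_self.trans (Icc_subset_Icc hx hy)),
      hGbv.vectorMeasure_Ioc hxy, hr, hr, hGF x hx', hGF y hy', rLim_eq hF hx', rLim_eq hF hy']
  · have ha : a ∈ Icc a b := left_mem_Icc.2 hab
    rw [VectorMeasure.restrict_apply _ measurableSet_Icc (measurableSet_singleton a),
      inter_eq_left.2 (singleton_subset_iff.2 ha), hGbv.vectorMeasure_singleton, hr, hl,
      rLim_eq hF ha, sub_self, sub_self]

instance (ν : SignedMeasure ℝ) : IsFiniteMeasure ν.totalVariation := by
  unfold SignedMeasure.totalVariation; infer_instance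

theorem signedMeasure_apply_eq_sub (ν : SignedMeasure ℝ) {s : Set ℝ} (hs : MeasurableSet s) :
    ν s = ν.toJordanDecomposition.posPart.real s - ν.toJordanDecomposition.negPart.real s := by
  conv_lhs => rw [← ν.toSignedMeasure_toJordanDecomposition]
  rw [JordanDecomposition.toSignedMeasure, Measure.toSignedMeasure_sub_apply hs]

theorem totalVariation_real (ν : SignedMeasure ℝ) (s : Set ℝ) :
    ν.totalVariation.real s =
      ν.toJordanDecomposition.posPart.real s + ν.toJordanDecomposition.negPart.real s := by
  rw [SignedMeasure.totalVariation, measureReal_add_apply]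

theorem massIoc_mono {μ μ' : Measure ℝ} [IsFiniteMeasure μ'] (h : μ ≤ μ') (p : ℝ × ℝ) :
    massIoc μ p ≤ massIoc μ' p :=
  ENNReal.toReal_mono (measure_ne_top _ _) (h _)

theorem incr_isBigO_mass {F : ℝ → ℝ} {ν : SignedMeasure ℝ} {μ : Measure ℝ} [IsFiniteMeasure μ]
    (hν : HasIncr a b F ν) (hμ : ν.totalVariation ≤ μ) :
    incr F =O[meshFilter a b] massIoc μ := by
  refine IsBigO.of_bound 1 ?_
  filter_upwards [eventually_mem_meshFilter] with p hp
  have h := hν p.1 p.2 hp.1 hp.2.1 hp.2.2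
  have h1 := massIoc_mono hμ p
  rw [massIoc, totalVariation_real] at h1
  rw [incr, ← h, signedMeasure_apply_eq_sub ν measurableSet_Ioc, one_mul, Real.norm_eq_abs,
    Real.norm_eq_abs, abs_of_nonneg (show 0 ≤ massIoc μ p from measureReal_nonneg)]
  refine (abs_le.2 ⟨?_, ?_⟩).trans h1 <;>
  linarith [measureReal_nonneg (μ := ν.toJordanDecomposition.posPart) (s := Ioc p.1 p.2),
    measureReal_nonneg (μ := ν.toJordanDecomposition.negPart) (s := Ioc p.1 p.2)]

theorem massIoc_isBigO_one {μ : Measure ℝ} [IsFiniteMeasure μ] {l : Filter (ℝ × ℝ)} :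
    massIoc μ =O[l] (fun _ => (1 : ℝ)) := by
  refine IsBigO.of_bound (μ.real univ) (.of_forall fun p => ?_)
  rw [norm_one, mul_one, Real.norm_eq_abs, abs_of_nonneg (show 0 ≤ massIoc μ p from
    measureReal_nonneg)]
  exact measureReal_mono (subset_univ _)

theorem integrableOn_of_subset_Icc {g : ℝ → ℝ} (hg : ContinuousOn g (Icc a b)) (μ : Measure ℝ)
    [IsFiniteMeasure μ] {s : Set ℝ} (hs : s ⊆ Icc a b) : IntegrableOn g s μ :=
  (hg.integrableOn_compact isCompact_Icc).mono_set hs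

theorem sInt_union (ν : SignedMeasure ℝ) {g : ℝ → ℝ} (hg : ContinuousOn g (Icc a b))
    {s t : Set ℝ} (hst : Disjoint s t) (ht : MeasurableSet t) (hs : s ⊆ Icc a b)
    (ht' : t ⊆ Icc a b) : sInt ν g (s ∪ t) = sInt ν g s + sInt ν g t := by
  unfold sInt
  rw [setIntegral_union hst ht (integrableOn_of_subset_Icc hg _ hs)
      (integrableOn_of_subset_Icc hg _ ht'),
    setIntegral_union hst ht (integrableOn_of_subset_Icc hg _ hs)
      (integrableOn_of_subset_Icc hg _ ht')]
  ring

theorem sInt_Ioc_add (ν : SignedMeasure ℝ) {g : ℝ → ℝ} (hg : ContinuousOn g (Icc a b))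
    {x y z : ℝ} (hx : a ≤ x) (hxy : x ≤ y) (hyz : y ≤ z) (hz : z ≤ b) :
    sInt ν g (Ioc x z) = sInt ν g (Ioc x y) + sInt ν g (Ioc y z) := by
  rw [← Ioc_union_Ioc_eq_Ioc hxy hyz]
  exact sInt_union ν hg (Ioc_disjoint_Ioc_of_le le_rfl) measurableSet_Ioc
    (Ioc_subset_Icc_self.trans (Icc_subset_Icc hx (hyz.trans hz)))
    (Ioc_subset_Icc_self.trans (Icc_subset_Icc (hx.trans hxy) hz))

theorem sInt_Icc_eq_Ioc {F : ℝ → ℝ} {ν : SignedMeasure ℝ} (hab : a ≤ b) (h : IsLS a b F ν)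
    (hF : ContinuousOn F (Icc a b)) {g : ℝ → ℝ} (hg : ContinuousOn g (Icc a b)) :
    sInt ν g (Icc a b) = sInt ν g (Ioc a b) := by
  have ha : a ∈ Icc a b := left_mem_Icc.2 hab
  have h0 : sInt ν g {a} = 0 := by
    have h1 := h.2.2
    rw [rLim_eq hF ha, sub_self, signedMeasure_apply_eq_sub ν (measurableSet_singleton a)] at h1
    simp only [sInt, integral_singleton, smul_eq_mul]
    rw [← sub_mul, h1, zero_mul]
  rw [← Icc_union_Ioc_eq_Icc le_rfl hab, Icc_self, sInt_union ν hg _ measurableSet_Ioc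
    (singleton_subset_iff.2 ha) Ioc_subset_Icc_self, h0, zero_add]
  simp

theorem abs_setIntegral_sub_le {g : ℝ → ℝ} {s : Set ℝ} {μ : Measure ℝ} [IsFiniteMeasure μ]
    (hg : IntegrableOn g s μ) {c ε : ℝ} (h : ∀ z ∈ s, |g z - c| ≤ ε) :
    |(∫ z in s, g z ∂μ) - c * μ.real s| ≤ ε * μ.real s := by
  have h1 : (∫ z in s, g z ∂μ) - c * μ.real s = ∫ z in s, (g z - c) ∂μ := by
    rw [integral_sub hg (integrable_const c), setIntegral_const, smul_eq_mul, mul_comm]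
  rw [h1, ← Real.norm_eq_abs]
  exact norm_setIntegral_le_of_norm_le_const (measure_lt_top _ _) h

/-- The integral over a short interval is well approximated by its Riemann–Stieltjes term. -/
theorem sInt_sub_isLittleO {F g : ℝ → ℝ} {ν : SignedMeasure ℝ} {μ : Measure ℝ}
    [IsFiniteMeasure μ] (hν : HasIncr a b F ν) (hμ : ν.totalVariation ≤ μ)
    (hg : ContinuousOn g (Icc a b)) :
    (fun p : ℝ × ℝ => sInt ν g (Ioc p.1 p.2) - g p.1 * incr F p)
      =o[meshFilter a b] massIoc μ := by
  rw [isLittleO_iff]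
  intro ε hε
  obtain ⟨δ, hδ, h⟩ := Metric.uniformContinuousOn_iff.1
    (isCompact_Icc.uniformContinuousOn_of_continuous hg) ε hε
  have h2 : ∀ᶠ p in meshFilter a b, dist p.1 p.2 < δ :=
    mem_inf_of_left (Metric.dist_mem_uniformity hδ)
  filter_upwards [eventually_mem_meshFilter, h2] with p hp hd
  have hsub : Ioc p.1 p.2 ⊆ Icc a b :=
    Ioc_subset_Icc_self.trans (Icc_subset_Icc hp.1 hp.2.2)
  have hosc : ∀ z ∈ Ioc p.1 p.2, |g z - g p.1| ≤ ε := by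
    intro z hz
    refine (h z (hsub hz) p.1 ⟨hp.1, hp.2.1.trans hp.2.2⟩ ?_).le
    rw [Real.dist_eq, abs_of_nonneg (by linarith [hz.1])]
    rw [dist_comm, Real.dist_eq, abs_of_nonneg (by linarith [hp.2.1])] at hd
    linarith [hz.2]
  have e1 := abs_setIntegral_sub_le (μ := ν.toJordanDecomposition.posPart)
    (integrableOn_of_subset_Icc hg _ hsub) hosc
  have e2 := abs_setIntegral_sub_le (μ := ν.toJordanDecomposition.negPart)
    (integrableOn_of_subset_Icc hg _ hsub) hosc
  have h1 := massIoc_mono hμ p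
  rw [massIoc, totalVariation_real] at h1
  rw [incr, ← hν p.1 p.2 hp.1 hp.2.1 hp.2.2, signedMeasure_apply_eq_sub ν measurableSet_Ioc, sInt,
    Real.norm_eq_abs, Real.norm_eq_abs,
    abs_of_nonneg (show 0 ≤ massIoc μ p from measureReal_nonneg)]
  refine le_trans ?_ (mul_le_mul_of_nonneg_left h1 hε.le)
  rw [abs_le] at e1 e2 ⊢
  constructor <;> linarith [e1.1, e1.2, e2.1, e2.2]

theorem sInt_Ioc_tendsto_zero {F g : ℝ → ℝ} {ν : SignedMeasure ℝ} (hν : HasIncr a b F ν)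
    (hF : ContinuousOn F (Icc a b)) (hg : ContinuousOn g (Icc a b)) :
    Tendsto (fun p : ℝ × ℝ => sInt ν g (Ioc p.1 p.2)) (meshFilter a b) (𝓝 0) := by
  rw [← isLittleO_one_iff ℝ]
  have h1 := (sInt_sub_isLittleO hν le_rfl hg).trans_isBigO
    (massIoc_isBigO_one (μ := ν.totalVariation))
  have h2 := (fst_isBigO_one hg).mul_isLittleO (incr_isLittleO_one hF)
  simp only [mul_one] at h2
  exact (h1.add h2).congr_left fun p => sub_add_cancel _ _

theorem sInt_Ioc_nonneg {F g : ℝ → ℝ} {ν : SignedMeasure ℝ} (hν : HasIncr a b F ν)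
    (hg : ContinuousOn g (Icc a b))
    (hgF : ∀ p : ℝ × ℝ, a ≤ p.1 → p.1 ≤ p.2 → p.2 ≤ b → 0 ≤ g p.1 * incr F p)
    {x y : ℝ} (hx : a ≤ x) (hxy : x ≤ y) (hy : y ≤ b) : 0 ≤ sInt ν g (Ioc x y) := by
  have h := le_of_increment_le_isLittleO (H := fun z => - sInt ν g (Ioc a z))
    (sInt_sub_isLittleO hν le_rfl hg).neg_left ?_ hx hxy hy
  · linarith [sInt_Ioc_add ν hg le_rfl hx hxy hy]
  · filter_upwards [eventually_mem_meshFilter] with p hp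
    have := sInt_Ioc_add ν hg le_rfl hp.1 hp.2.1 hp.2.2
    have h0 := hgF p hp.1 hp.2.1 hp.2.2
    simp only [incr] at h0 ⊢
    linarith

theorem sInt_neg (ν : SignedMeasure ℝ) (g : ℝ → ℝ) (s : Set ℝ) :
    sInt ν (fun x => -g x) s = -sInt ν g s := by
  simp only [sInt, integral_neg]; ring

theorem sInt_Ioc_nonneg_of_monotoneOn {F g : ℝ → ℝ} {ν : SignedMeasure ℝ}
    (hν : HasIncr a b F ν) (hF : MonotoneOn F (Icc a b)) (hg : ContinuousOn g (Icc a b))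
    (hg0 : ∀ x ∈ Icc a b, 0 ≤ g x) {x y : ℝ} (hx : a ≤ x) (hxy : x ≤ y) (hy : y ≤ b) :
    0 ≤ sInt ν g (Ioc x y) := by
  refine sInt_Ioc_nonneg hν hg (fun p h1 h2 h3 => mul_nonneg (hg0 _ ⟨h1, h2.trans h3⟩) ?_) hx hxy hy
  exact sub_nonneg.2 (hF ⟨h1, h2.trans h3⟩ ⟨h1.trans h2, h3⟩ h2)

theorem sInt_Ioc_nonpos_of_antitoneOn {F g : ℝ → ℝ} {ν : SignedMeasure ℝ}
    (hν : HasIncr a b F ν) (hF : AntitoneOn F (Icc a b)) (hg : ContinuousOn g (Icc a b))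
    (hg0 : ∀ x ∈ Icc a b, 0 ≤ g x) {x y : ℝ} (hx : a ≤ x) (hxy : x ≤ y) (hy : y ≤ b) :
    sInt ν g (Ioc x y) ≤ 0 := by
  have h : 0 ≤ sInt ν (fun x => -g x) (Ioc x y) := by
    refine sInt_Ioc_nonneg hν hg.neg (fun p h1 h2 h3 => mul_nonneg_of_nonpos_of_nonpos
      (neg_nonpos.2 (hg0 _ ⟨h1, h2.trans h3⟩)) ?_) hx hxy hy
    exact sub_nonpos.2 (hF ⟨h1, h2.trans h3⟩ ⟨h1.trans h2, h3⟩ h2)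
  rw [sInt_neg] at h
  linarith

theorem sInf_image_eq_of_tendsto {F : ℝ → ℝ} {s : Set ℝ} {l : Filter ℝ} [l.NeBot] {L : ℝ}
    (hl : ∀ᶠ x in l, x ∈ s) (hF : Tendsto F l (𝓝 L)) (hL : ∀ x ∈ s, L ≤ F x) :
    sInf (F '' s) = L := by
  obtain ⟨x, hx⟩ := hl.exists
  refine IsGLB.csInf_eq ⟨forall_mem_image.2 hL, fun c hc => ?_⟩ ⟨F x, mem_image_of_mem F hx⟩
  refine ge_of_tendsto hF ?_
  filter_upwards [hl] with y hy using hc (mem_image_of_mem F hy)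

theorem tendsto_prodMk_right_meshFilter (hab : a < b) :
    Tendsto (fun x => (x, b)) (𝓝[<] b) (meshFilter a b) := by
  refine tendsto_inf.2 ⟨?_, tendsto_principal.2 ?_⟩
  · refine Tendsto.mono_right ?_ (nhds_le_uniformity b)
    exact ((continuous_id.prodMk continuous_const).tendsto b).mono_left nhdsWithin_le_nhds
  · filter_upwards [Ioo_mem_nhdsLT hab] with x hx using ⟨hx.1.le, hx.2.le, le_rfl⟩

theorem tendsto_prodMk_left_meshFilter (hab : a < b) :
    Tendsto (fun x => (a, x)) (𝓝[>] a) (meshFilter a b) := by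
  refine tendsto_inf.2 ⟨?_, tendsto_principal.2 ?_⟩
  · refine Tendsto.mono_right ?_ (nhds_le_uniformity a)
    exact ((continuous_const.prodMk continuous_id).tendsto a).mono_left nhdsWithin_le_nhds
  · filter_upwards [Ioo_mem_nhdsGT hab] with x hx using ⟨le_rfl, hx.1.le, hx.2.le⟩

theorem isLittleO_mul_increments {μ : Measure ℝ} {c F G : ℝ → ℝ}
    (hc : ContinuousOn c (Icc a b)) (hF : ContinuousOn F (Icc a b))
    (hG : incr G =O[meshFilter a b] massIoc μ) :
    (fun p : ℝ × ℝ => c p.1 * (incr F p * incr G p)) =o[meshFilter a b] massIoc μ := by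
  simpa using (fst_isBigO_one hc).mul_isLittleO ((incr_isLittleO_one hF).mul_isBigO hG)

/-- Along a solution of Luckock's equation, the quantity `f₊ λ₋ + f₋ λ₊` is constant, and
`f₊ / λ₊` is a primitive of this constant times `(1 / λ₋) d(1 / λ₊)`. -/
theorem LuckockSol.conservation (hab : a < b) {lm lp fm fp : ℝ → ℝ} (hA3 : A3 a b lm lp)
    (hlm : ∀ x ∈ Icc a b, 0 < lm x) (hlp : ∀ x ∈ Icc a b, 0 < lp x)
    (hsol : LuckockSol a b lm lp fm fp) {νip : SignedMeasure ℝ}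
    (hνip : IsLS a b (fun x => (lp x)⁻¹) νip) :
    fp b * lm b + fm b * lp b = fp a * lm a + fm a * lp a ∧
    fp b * (lp b)⁻¹ = fp a * (lp a)⁻¹ +
      (fp a * lm a + fm a * lp a) * sInt νip (fun x => (lm x)⁻¹) (Ioc a b) := by
  obtain ⟨clm, clp, alm, mlp, -, -⟩ := hA3
  obtain ⟨cfm, cfp, bfm, bfp, -, -, hE⟩ := hsol
  have ha : a ∈ Icc a b := left_mem_Icc.2 hab.le
  have hb : b ∈ Icc a b := right_mem_Icc.2 hab.le
  have blp : BoundedVariationOn lp (Icc a b) := by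
    obtain ⟨C, hC⟩ := isCompact_Icc.exists_bound_of_continuousOn clp
    exact mlp.boundedVariationOn hC
  have blm : BoundedVariationOn lm (Icc a b) := by
    obtain ⟨C, hC⟩ := isCompact_Icc.exists_bound_of_continuousOn clm
    have h := (show MonotoneOn (fun x => -lm x) (Icc a b) from alm.neg).boundedVariationOn
      (C := C) (by simpa using hC)
    simpa [BoundedVariationOn, eVariationOn, edist_neg_neg] using h
  have cQ : ContinuousOn (fun x => (lm x)⁻¹) (Icc a b) := clm.inv₀ fun x hx => (hlm x hx).ne'
  have cP : ContinuousOn (fun x => (lp x)⁻¹) (Icc a b) := clp.inv₀ fun x hx => (hlp x hx).ne'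
  obtain ⟨ν₁, h₁⟩ := exists_isLS hab.le clm blm
  obtain ⟨ν₂, h₂⟩ := exists_isLS hab.le clp blp
  obtain ⟨ν₃, h₃⟩ := exists_isLS hab.le cfm bfm
  obtain ⟨ν₄, h₄⟩ := exists_isLS hab.le cfp bfp
  have E := hE ν₁ ν₂ ν₃ ν₄ h₁ h₂ h₃ h₄
  have i₁ := h₁.hasIncr clm
  have i₂ := h₂.hasIncr clp
  have i₃ := h₃.hasIncr cfm
  have i₄ := h₄.hasIncr cfp
  have i₅ := hνip.hasIncr cP
  set μ := ν₁.totalVariation + (ν₂.totalVariation + (ν₃.totalVariation + (ν₄.totalVariation +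
    νip.totalVariation))) with hμ
  have m₁ : ν₁.totalVariation ≤ μ := Measure.le_add_right le_rfl
  have m₂ : ν₂.totalVariation ≤ μ := Measure.le_add_left (Measure.le_add_right le_rfl)
  have m₃ : ν₃.totalVariation ≤ μ :=
    Measure.le_add_left (Measure.le_add_left (Measure.le_add_right le_rfl))
  have m₄ : ν₄.totalVariation ≤ μ := Measure.le_add_left (Measure.le_add_left
    (Measure.le_add_left (Measure.le_add_right le_rfl)))
  have m₅ : νip.totalVariation ≤ μ := Measure.le_add_left (Measure.le_add_left
    (Measure.le_add_left (Measure.le_add_left le_rfl)))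
  have e1 : (fun p : ℝ × ℝ => fm p.1 * incr lp p + lm p.1 * incr fp p)
      =o[meshFilter a b] massIoc μ := by
    refine ((sInt_sub_isLittleO i₂ m₂ cfm).add (sInt_sub_isLittleO i₄ m₄ clm)).neg_left.congr_left
      fun p => ?_
    linarith [(E (Ioc p.1 p.2) measurableSet_Ioc).1]
  have e2 : (fun p : ℝ × ℝ => fp p.1 * incr lm p + lp p.1 * incr fm p)
      =o[meshFilter a b] massIoc μ := by
    refine ((sInt_sub_isLittleO i₁ m₁ cfp).add (sInt_sub_isLittleO i₃ m₃ clp)).neg_left.congr_left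
      fun p => ?_
    linarith [(E (Ioc p.1 p.2) measurableSet_Ioc).2]
  have hκ : ∀ x ∈ Icc a b, fp x * lm x + fm x * lp x = fp a * lm a + fm a * lp a := by
    intro x hx
    refine eq_of_increment_isLittleO (μ := μ) (H := fun x => fp x * lm x + fm x * lp x) ?_
      le_rfl hx.1 hx.2
    have r1 := isLittleO_mul_increments (c := fun _ => 1) continuousOn_const cfp
      (incr_isBigO_mass i₁ m₁)
    have r2 := isLittleO_mul_increments (c := fun _ => 1) continuousOn_const cfm
      (incr_isBigO_mass i₂ m₂)
    refine ((e1.add e2).add (r1.add r2)).congr_left fun p => ?_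
    simp only [incr]
    ring
  refine ⟨hκ b hb, ?_⟩
  set κ := fp a * lm a + fm a * lp a
  have hG := eq_of_increment_isLittleO (a := a) (b := b) (μ := μ) (H := fun x => fp x * (lp x)⁻¹ -
    κ * sInt νip (fun x => (lm x)⁻¹) (Ioc a x)) ?_ le_rfl hab.le le_rfl
  · have h0 : sInt νip (fun x => (lm x)⁻¹) (Ioc a a) = 0 := by simp [sInt]
    simp only [h0] at hG
    linarith
  have r1 := isLittleO_mul_increments (c := fun _ => 1) continuousOn_const cfp
    (incr_isBigO_mass i₅ m₅)
  have r2 := isLittleO_mul_increments (cfm.mul cQ) cP (incr_isBigO_mass i₂ m₂)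
  have r3 := (fst_isBigO_one (cP.mul cQ)).mul_isLittleO e1
  simp only [one_mul] at r3
  have r4 := (sInt_sub_isLittleO i₅ m₅ cQ).const_mul_left κ
  refine ((r3.add (r1.add r2)).sub r4).congr' ?_ .rfl
  filter_upwards [eventually_mem_meshFilter, eventually_fst_mem, eventually_snd_mem]
    with p hp h1 h2
  have hs := sInt_Ioc_add νip cQ le_rfl hp.1 hp.2.1 hp.2.2
  have := (hlm _ h1).ne'
  have := (hlp _ h1).ne'
  have := (hlp _ h2).ne'
  simp only [incr, hs, Pi.mul_apply, ← hκ _ h1]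
  field_simp
  ring

end

/-- extremal weight functions: under (A3) and (A6), with `(fm, fp)` the
unique solution of Luckock's equation and with the extremal weight functions
`w⁽⁻⁾₋ = u₋₊/λ₊(a)`, `w⁽⁻⁾₊ = −(1−u₊₋)/λ₊(a)`, `w⁽⁺⁾₋ = −(1−u₋₊)/λ₋(b)`,
`w⁽⁺⁾₊ = u₊₋/λ₋(b)` on `I = (a,b)`, one has `fp b > 0` iff
`inf_{x ∈ I} [w⁽⁻⁾₋(x) + w⁽⁺⁾₋(x)] > 0` and `fm a > 0` iff
`inf_{x ∈ I} [w⁽⁻⁾₊(x) + w⁽⁺⁾₊(x)] > 0`; both equivalences also hold with `>`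
replaced by `<`.  Here `νip, νim` are the Lebesgue-Stieltjes measures of
`1/λ₊, 1/λ₋` on `[a,b]`. -/
theorem stmt11 (a b : ℝ) (hab : a < b) (lm lp : ℝ → ℝ)
    (hA3 : A3 a b lm lp) (hA6 : A6 a b lm lp)
    (fm fp : ℝ → ℝ) (hsol : LuckockSol a b lm lp fm fp)
    (νip νim : MeasureTheory.SignedMeasure ℝ)
    (hνip : IsLS a b (fun x => (lp x)⁻¹) νip)
    (hνim : IsLS a b (fun x => (lm x)⁻¹) νim) :
    (0 < fp b ↔
      0 < sInf ((fun x => ump a b lm lp νip x / lp a +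
        -((1 - ump a b lm lp νip x) / lm b)) '' Set.Ioo a b)) ∧
    (0 < fm a ↔
      0 < sInf ((fun x => -((1 - upm a b lm lp νip νim x) / lp a) +
        upm a b lm lp νip νim x / lm b) '' Set.Ioo a b)) ∧
    (fp b < 0 ↔
      sInf ((fun x => ump a b lm lp νip x / lp a +
        -((1 - ump a b lm lp νip x) / lm b)) '' Set.Ioo a b) < 0) ∧
    (fm a < 0 ↔
      sInf ((fun x => -((1 - upm a b lm lp νip νim x) / lp a) +
        upm a b lm lp νip νim x / lm b) '' Set.Ioo a b) < 0) := by
  obtain ⟨clm, clp, alm, mlp, -, -⟩ := id hA3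
  have ha : a ∈ Icc a b := left_mem_Icc.2 hab.le
  have hb : b ∈ Icc a b := right_mem_Icc.2 hab.le
  have hlm : ∀ x ∈ Icc a b, 0 < lm x := fun x hx => hA6.2.trans_le (alm hx hb hx.2)
  have hlp : ∀ x ∈ Icc a b, 0 < lp x := fun x hx => hA6.1.trans_le (mlp ha hx hx.1)
  have cQ : ContinuousOn (fun x => (lm x)⁻¹) (Icc a b) := clm.inv₀ fun x hx => (hlm x hx).ne'
  have cP : ContinuousOn (fun x => (lp x)⁻¹) (Icc a b) := clp.inv₀ fun x hx => (hlp x hx).ne'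
  have aP : AntitoneOn (fun x => (lp x)⁻¹) (Icc a b) := fun x hx y hy h =>
    inv_anti₀ (hlp x hx) (mlp hx hy h)
  have mQ : MonotoneOn (fun x => (lm x)⁻¹) (Icc a b) := fun x hx y hy h =>
    inv_anti₀ (hlm y hy) (alm hx hy h)
  obtain ⟨hκ, hJ⟩ := hsol.conservation hab hA3 hlm hlp hνip
  obtain ⟨-, -, -, -, hfm, hfp, -⟩ := hsol
  have iP := hνip.hasIncr cP
  have iQ := hνim.hasIncr cQ
  have lpa := hlp a ha
  have lpb := hlp b hb
  have lma := hlm a ha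
  have lmb := hlm b hb
  set Γ := Gam a b lm lp νip with hΓ
  rw [Gam, sInt_Icc_eq_Ioc hab.le hνip cP cQ] at hΓ
  have hΓ0 : 0 < Γ := by
    have h1 := sInt_Ioc_nonpos_of_antitoneOn iP aP cQ (fun x hx => (inv_pos.2 (hlm x hx)).le)
      le_rfl hab.le le_rfl
    have : 0 < (lm b * lp b)⁻¹ := by positivity
    linarith
  rw [hfm, hfp] at hκ
  rw [hfp] at hJ
  set κ := 1 * lm a + fm a * lp a with hκdef
  have hκΓ : κ * Γ = (lp a)⁻¹ + (lm b)⁻¹ := by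
    have h1 : κ * (lm b * lp b)⁻¹ = fp b * (lp b)⁻¹ + (lm b)⁻¹ := by
      rw [← hκ]; field_simp
    rw [hΓ, mul_sub, h1]
    linarith
  have hκ' : Γ⁻¹ * ((lp a)⁻¹ + (lm b)⁻¹) = κ := by
    rw [← hκΓ]; field_simp
  have hκ0 : 0 ≤ κ := by rw [← hκ']; positivity
  have inf₁ : sInf ((fun x => ump a b lm lp νip x / lp a +
      -((1 - ump a b lm lp νip x) / lm b)) '' Ioo a b) = fp b / lp b := by
    have hfun : ∀ x, ump a b lm lp νip x / lp a + -((1 - ump a b lm lp νip x) / lm b) =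
        fp b / lp b - κ * sInt νip (fun t => (lm t)⁻¹) (Ioc x b) := by
      intro x
      have h1 : fp b / lp b = κ * (lm b * lp b)⁻¹ - (lm b)⁻¹ := by
        rw [← hκ]; field_simp; ring
      rw [h1, ← hκ', ump]
      ring
    simp only [hfun]
    refine sInf_image_eq_of_tendsto (l := 𝓝[<] b) (Ioo_mem_nhdsLT hab) ?_ fun x hx => ?_
    · have := (sInt_Ioc_tendsto_zero iP cP cQ).comp (tendsto_prodMk_right_meshFilter hab)
      simpa using (this.const_mul κ).const_sub (fp b / lp b)
    · have := sInt_Ioc_nonpos_of_antitoneOn iP aP cQ (fun x hx => (inv_pos.2 (hlm x hx)).le)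
        hx.1.le hx.2.le le_rfl
      linarith [mul_nonpos_of_nonneg_of_nonpos hκ0 this]
  have inf₂ : sInf ((fun x => -((1 - upm a b lm lp νip νim x) / lp a) +
      upm a b lm lp νip νim x / lm b) '' Ioo a b) = fm a / lm a := by
    have hfun : ∀ x, -((1 - upm a b lm lp νip νim x) / lp a) + upm a b lm lp νip νim x / lm b =
        fm a / lm a + κ * sInt νim (fun t => (lp t)⁻¹) (Ioc a x) := by
      intro x
      have h1 : fm a / lm a = κ * (lm a * lp a)⁻¹ - (lp a)⁻¹ := by
        rw [hκdef]; field_simp; ring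
      rw [h1, ← hκ', upm]
      ring
    simp only [hfun]
    refine sInf_image_eq_of_tendsto (l := 𝓝[>] a) (Ioo_mem_nhdsGT hab) ?_ fun x hx => ?_
    · have := (sInt_Ioc_tendsto_zero iQ cQ cP).comp (tendsto_prodMk_left_meshFilter hab)
      simpa using (this.const_mul κ).const_add (fm a / lm a)
    · have := sInt_Ioc_nonneg_of_monotoneOn iQ mQ cP (fun x hx => (inv_pos.2 (hlp x hx)).le)
        le_rfl hx.1.le hx.2.le
      linarith [mul_nonneg hκ0 this]
  rw [inf₁, inf₂]
  simp only [div_pos_iff_of_pos_right lpb, div_pos_iff_of_pos_right lma,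
    div_neg_iff, lpb, lma, lpb.not_gt, lma.not_gt, and_true, and_false, false_or, iff_self]
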